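/- Let M be a finite-dimensional complex left central Leibniz algebra whose Leibniz kernel N = C(M) has dimension r ≥ 1. Then there exist hyperplanes N₁, …, N_r of N with ∩ᵢ Nᵢ = 0, each Nᵢ is a two-sided ideal of M, each quotient M/Nᵢ is a left central Leibniz algebra with dim C(M/Nᵢ) = 1, and the map M → M/N₁ ⊕ ⋯ ⊕ M/N_r, a ↦ (a+N₁, …, a+N_r), is an injective morphism of Leibniz algebras into the orthogonal sum (the direct sum with componentwise bracket). -/

import Mathlib

open Submodule

section LeibnizDefs

variable {M : Type*} [AddCommGroup M] [Module ℂ M]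

/-- The left Leibniz identity for a bilinear bracket. -/
def IsLeftLeibniz (br : M →ₗ[ℂ] M →ₗ[ℂ] M) : Prop :=
  ∀ a b c : M, br a (br b c) = br (br a b) c + br b (br a c)

/-- The right Leibniz identity for a bilinear bracket. -/
def IsRightLeibniz (br : M →ₗ[ℂ] M →ₗ[ℂ] M) : Prop :=
  ∀ a b c : M, br (br a b) c = br (br a c) b + br a (br b c)

/-- Left central: `[a,[b,b]] = 0` for all `a, b`. -/
def IsLeftCentral (br : M →ₗ[ℂ] M →ₗ[ℂ] M) : Prop :=
  ∀ a b : M, br a (br b b) = 0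

/-- The Leibniz kernel `C(M)`, the span of all squares `[a,a]`. -/
def leibnizKernel (br : M →ₗ[ℂ] M →ₗ[ℂ] M) : Submodule ℂ M :=
  Submodule.span ℂ {x | ∃ a : M, br a a = x}

/-- A two-sided ideal of a Leibniz algebra. -/
def IsTwoSidedIdeal (br : M →ₗ[ℂ] M →ₗ[ℂ] M) (U : Submodule ℂ M) : Prop :=
  ∀ m u : M, u ∈ U → br m u ∈ U ∧ br u m ∈ U

/-- A Lie subalgebra: a subspace closed under the bracket on which the bracket is alternating. -/
def IsLieSubalgebra (br : M →ₗ[ℂ] M →ₗ[ℂ] M) (L : Submodule ℂ M) : Prop :=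
  (∀ a ∈ L, ∀ b ∈ L, br a b ∈ L) ∧ ∀ a ∈ L, br a a = 0

/-- The derived series of a subspace. -/
def leibDerivedSeries (br : M →ₗ[ℂ] M →ₗ[ℂ] M) (U : Submodule ℂ M) : ℕ → Submodule ℂ M
  | 0 => U
  | n + 1 => Submodule.span ℂ
      {x | ∃ a ∈ leibDerivedSeries br U n, ∃ b ∈ leibDerivedSeries br U n, br a b = x}

/-- Solvability of a subspace. -/
def IsLeibnizSolvable (br : M →ₗ[ℂ] M →ₗ[ℂ] M) (U : Submodule ℂ M) : Prop :=
  ∃ n : ℕ, leibDerivedSeries br U n = ⊥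

/-- `B` is the solvable radical: the largest solvable two-sided ideal. -/
def IsSolvableRadical (br : M →ₗ[ℂ] M →ₗ[ℂ] M) (B : Submodule ℂ M) : Prop :=
  IsTwoSidedIdeal br B ∧ IsLeibnizSolvable br B ∧
    ∀ U : Submodule ℂ M, IsTwoSidedIdeal br U → IsLeibnizSolvable br U → U ≤ B

/-- Semisimplicity of a bracket-closed subspace `S` on which the bracket is a Lie bracket,
expressed via the standard characterization (valid for finite-dimensional complex Lie
algebras): `S` has no nonzero abelian ideal. -/
def IsSemisimpleSubalgebra (br : M →ₗ[ℂ] M →ₗ[ℂ] M) (S : Submodule ℂ M) : Prop :=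
  ∀ A : Submodule ℂ M, A ≤ S →
    (∀ s ∈ S, ∀ a ∈ A, br s a ∈ A ∧ br a s ∈ A) →
    (∀ a ∈ A, ∀ b ∈ A, br a b = 0) → A = ⊥

/-- The truncated exponential series of an endomorphism; if `f ^ n = 0` this is `exp f`. -/
noncomputable def expSum (f : Module.End ℂ M) (n : ℕ) : Module.End ℂ M :=
  ∑ i ∈ Finset.range n, ((i.factorial : ℂ)⁻¹) • f ^ i

/-- A subspace `A` with `R ≤ A` whose image in `M/R` is a (two-sided) ideal. -/
def IsIdealAbove (br : M →ₗ[ℂ] M →ₗ[ℂ] M) (R A : Submodule ℂ M) : Prop :=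
  R ≤ A ∧ ∀ m a : M, a ∈ A → br m a ∈ A ∧ br a m ∈ A

/-- The derived series relative to `R` (computing the derived series of the image in `M/R`). -/
def derivedSeriesMod (br : M →ₗ[ℂ] M →ₗ[ℂ] M) (R U : Submodule ℂ M) : ℕ → Submodule ℂ M
  | 0 => U ⊔ R
  | n + 1 => Submodule.span ℂ
      {x | ∃ a ∈ derivedSeriesMod br R U n, ∃ b ∈ derivedSeriesMod br R U n, br a b = x} ⊔ R

/-- Solvability of the image of `U` in `M/R`. -/
def IsSolvableMod (br : M →ₗ[ℂ] M →ₗ[ℂ] M) (R U : Submodule ℂ M) : Prop :=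
  ∃ n : ℕ, derivedSeriesMod br R U n ≤ R

/-- `B/R` is the solvable radical of `M/R`. -/
def IsSolvableRadicalMod (br : M →ₗ[ℂ] M →ₗ[ℂ] M) (R B : Submodule ℂ M) : Prop :=
  IsIdealAbove br R B ∧ IsSolvableMod br R B ∧
    ∀ U : Submodule ℂ M, IsIdealAbove br R U → IsSolvableMod br R U → U ≤ B

/-- Semisimplicity of `L/R` as a Lie algebra, expressed via the standard characterization:
no ideal of `L/R` strictly between `R` and `L` is abelian, except the zero one. -/
def IsSemisimpleMod (br : M →ₗ[ℂ] M →ₗ[ℂ] M) (R L : Submodule ℂ M) : Prop :=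
  ∀ A : Submodule ℂ M, R ≤ A → A ≤ L →
    (∀ l ∈ L, ∀ a ∈ A, br l a ∈ A ∧ br a l ∈ A) →
    (∀ a ∈ A, ∀ b ∈ A, br a b ∈ R) → A = R

/-- The lower central series of `L` relative to `R`. -/
def lowerCentralSeriesMod (br : M →ₗ[ℂ] M →ₗ[ℂ] M) (R L : Submodule ℂ M) :
    ℕ → Submodule ℂ M
  | 0 => L ⊔ R
  | n + 1 => Submodule.span ℂ
      {x | ∃ a ∈ L, ∃ b ∈ lowerCentralSeriesMod br R L n, br a b = x} ⊔ R

/-- Nilpotency of `L/R`. -/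
def IsNilpotentMod (br : M →ₗ[ℂ] M →ₗ[ℂ] M) (R L : Submodule ℂ M) : Prop :=
  ∃ n : ℕ, lowerCentralSeriesMod br R L n ≤ R

/-- A totally isotropic subspace for the pairing `ψ(a,b) = [a,b] + [b,a]`. -/
def IsTotallyIsotropic (br : M →ₗ[ℂ] M →ₗ[ℂ] M) (U : Submodule ℂ M) : Prop :=
  ∀ a ∈ U, ∀ b ∈ U, br a b + br b a = 0

end LeibnizDefs

section QuotBr

variable {M : Type*} [AddCommGroup M] [Module ℂ M]

/-- The bracket induced on the quotient `M ⧸ U` by a two-sided ideal `U`. -/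
noncomputable def quotBr (br : M →ₗ[ℂ] M →ₗ[ℂ] M) (U : Submodule ℂ M)
    (h : ∀ m u : M, u ∈ U → br m u ∈ U ∧ br u m ∈ U) :
    (M ⧸ U) →ₗ[ℂ] (M ⧸ U) →ₗ[ℂ] M ⧸ U :=
  U.liftQ
    { toFun := fun x => U.liftQ (U.mkQ ∘ₗ br x)
        (fun u hu => by
          simp only [LinearMap.mem_ker, LinearMap.comp_apply, Submodule.mkQ_apply,
            Submodule.Quotient.mk_eq_zero]
          exact (h x u hu).1)
      map_add' := fun x y => by
        refine U.linearMap_qext ?_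
        ext z
        simp [map_add]
      map_smul' := fun c x => by
        refine U.linearMap_qext ?_
        ext z
        simp }
    (by
      intro u hu
      simp only [LinearMap.mem_ker]
      refine U.linearMap_qext ?_
      ext z
      simpa [Submodule.Quotient.mk_eq_zero] using (h z u hu).2)

end QuotBr

section QuotBrLemmas

variable {M : Type*} [AddCommGroup M] [Module ℂ M]

theorem quotBr_mk_mk (br : M →ₗ[ℂ] M →ₗ[ℂ] M) (U : Submodule ℂ M)
    (h : ∀ m u : M, u ∈ U → br m u ∈ U ∧ br u m ∈ U) (a b : M) :
    quotBr br U h (U.mkQ a) (U.mkQ b) = U.mkQ (br a b) := rfl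

theorem IsLeftLeibniz.quotBr {br : M →ₗ[ℂ] M →ₗ[ℂ] M} (hbr : IsLeftLeibniz br)
    (U : Submodule ℂ M) (h : ∀ m u : M, u ∈ U → br m u ∈ U ∧ br u m ∈ U) :
    IsLeftLeibniz (quotBr br U h) := by
  intro a b c
  obtain ⟨a, rfl⟩ := U.mkQ_surjective a
  obtain ⟨b, rfl⟩ := U.mkQ_surjective b
  obtain ⟨c, rfl⟩ := U.mkQ_surjective c
  simp only [quotBr_mk_mk, ← map_add, hbr a b c]

theorem IsLeftCentral.quotBr {br : M →ₗ[ℂ] M →ₗ[ℂ] M} (hbr : IsLeftCentral br)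
    (U : Submodule ℂ M) (h : ∀ m u : M, u ∈ U → br m u ∈ U ∧ br u m ∈ U) :
    IsLeftCentral (quotBr br U h) := by
  intro a b
  obtain ⟨a, rfl⟩ := U.mkQ_surjective a
  obtain ⟨b, rfl⟩ := U.mkQ_surjective b
  simp only [quotBr_mk_mk, hbr a b, map_zero]

theorem leibnizKernel_quotBr (br : M →ₗ[ℂ] M →ₗ[ℂ] M) (U : Submodule ℂ M)
    (h : ∀ m u : M, u ∈ U → br m u ∈ U ∧ br u m ∈ U) :
    leibnizKernel (quotBr br U h) = (leibnizKernel br).map U.mkQ := by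
  rw [leibnizKernel, leibnizKernel, Submodule.map_span]
  congr 1
  ext x
  simp only [Set.mem_ofPred_eq, Set.mem_image, exists_exists_eq_and,
    U.mkQ_surjective.exists, quotBr_mk_mk]

theorem IsLeftCentral.bracket_leibnizKernel_right {br : M →ₗ[ℂ] M →ₗ[ℂ] M}
    (hbr : IsLeftCentral br) (m : M) {u : M} (hu : u ∈ leibnizKernel br) : br m u = 0 := by
  have hle : leibnizKernel br ≤ LinearMap.ker (br m) := by
    refine Submodule.span_le.2 ?_
    rintro _ ⟨a, rfl⟩
    exact hbr m a
  exact hle hu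

theorem IsLeftLeibniz.bracket_leibnizKernel_left {br : M →ₗ[ℂ] M →ₗ[ℂ] M}
    (hbr : IsLeftLeibniz br) (m : M) {u : M} (hu : u ∈ leibnizKernel br) : br u m = 0 := by
  have hle : leibnizKernel br ≤ LinearMap.ker (br.flip m) := by
    refine Submodule.span_le.2 ?_
    rintro _ ⟨a, rfl⟩
    exact right_eq_add.1 (hbr a a m)
  exact hle hu

end QuotBrLemmas

section CoordinateHyperplanes

variable {K V ι : Type*} [Field K] [AddCommGroup V] [Module K V] {N : Submodule K V}

/-- The vectors of `N` whose `i`-th coordinate in the basis `b` of `N` vanishes. -/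
noncomputable def coordHyperplane (b : Module.Basis ι K N) (i : ι) : Submodule K V :=
  (LinearMap.ker (b.coord i)).map N.subtype

theorem coordHyperplane_le (b : Module.Basis ι K N) (i : ι) : coordHyperplane b i ≤ N :=
  Submodule.map_subtype_le _ _

theorem iInf_coordHyperplane [Nonempty ι] (b : Module.Basis ι K N) :
    ⨅ i, coordHyperplane b i = ⊥ := by
  have hker : ⨅ i, LinearMap.ker (b.coord i) = ⊥ := by
    refine (Submodule.eq_bot_iff _).2 fun x hx => b.forall_coord_eq_zero_iff.1 fun i => ?_
    exact (Submodule.mem_iInf _).1 hx i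
  simp only [coordHyperplane]
  rw [← Submodule.map_iInf _ N.injective_subtype, hker, Submodule.map_bot]

theorem finrank_coordHyperplane_add_one [FiniteDimensional K V] (b : Module.Basis ι K N) (i : ι) :
    Module.finrank K (coordHyperplane b i) + 1 = Module.finrank K N := by
  rw [coordHyperplane, Submodule.finrank_map_subtype_eq]
  refine Module.Dual.finrank_ker_add_one_of_ne_zero fun h => ?_
  simpa using LinearMap.congr_fun h (b i)

theorem Submodule.finrank_map_mkQ_add_finrank [FiniteDimensional K V] {U : Submodule K V}
    (hU : U ≤ N) :
    Module.finrank K (N.map U.mkQ) + Module.finrank K U = Module.finrank K N := by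
  have h := LinearMap.finrank_range_add_finrank_ker (U.mkQ.domRestrict N)
  rwa [LinearMap.range_domRestrict, LinearMap.ker_domRestrict, Submodule.ker_mkQ,
    (Submodule.comapSubtypeEquivOfLe hU).finrank_eq] at h

end CoordinateHyperplanes

/-- A left central Leibniz algebra of rank `r ≥ 1` embeds in an
orthogonal sum of `r` left central Leibniz algebras of rank `1`, obtained as the quotients
by `r` hyperplanes of the Leibniz kernel intersecting in `0`. -/
theorem embed_in_orthogonal_sum_of_rank_one (M : Type*) [AddCommGroup M] [Module ℂ M]
    [FiniteDimensional ℂ M] (br : M →ₗ[ℂ] M →ₗ[ℂ] M) (hleib : IsLeftLeibniz br)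
    (hcent : IsLeftCentral br)
    (r : ℕ) (hr : 1 ≤ r) (hrk : Module.finrank ℂ (leibnizKernel br) = r) :
    ∃ (𝒩 : Fin r → Submodule ℂ M)
      (hideal : ∀ i, ∀ m u : M, u ∈ 𝒩 i → br m u ∈ 𝒩 i ∧ br u m ∈ 𝒩 i),
      (∀ i, 𝒩 i ≤ leibnizKernel br ∧ Module.finrank ℂ (𝒩 i) = r - 1) ∧
      (⨅ i, 𝒩 i) = ⊥ ∧
      (∀ i, IsLeftLeibniz (quotBr br (𝒩 i) (hideal i)) ∧
            IsLeftCentral (quotBr br (𝒩 i) (hideal i)) ∧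
            Module.finrank ℂ (leibnizKernel (quotBr br (𝒩 i) (hideal i))) = 1) ∧
      Function.Injective (fun (a : M) (i : Fin r) => (𝒩 i).mkQ a) ∧
      (∀ (a b : M) (i : Fin r),
        (𝒩 i).mkQ (br a b)
          = quotBr br (𝒩 i) (hideal i) ((𝒩 i).mkQ a) ((𝒩 i).mkQ b)) := by
  let b : Module.Basis (Fin r) ℂ (leibnizKernel br) := Module.finBasisOfFinrankEq ℂ _ hrk
  have : Nonempty (Fin r) := ⟨⟨0, hr⟩⟩
  have hideal : ∀ i, ∀ m u : M, u ∈ coordHyperplane b i →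
      br m u ∈ coordHyperplane b i ∧ br u m ∈ coordHyperplane b i := by
    intro i m u hu
    have hu' := coordHyperplane_le b i hu
    rw [hcent.bracket_leibnizKernel_right m hu', hleib.bracket_leibnizKernel_left m hu']
    exact ⟨zero_mem _, zero_mem _⟩
  have hfin (i : Fin r) := finrank_coordHyperplane_add_one b i
  refine ⟨coordHyperplane b, hideal, fun i => ⟨coordHyperplane_le b i, ?_⟩,
    iInf_coordHyperplane b,
    fun i => ⟨hleib.quotBr _ (hideal i), hcent.quotBr _ (hideal i), ?_⟩, ?_,
    fun _ _ _ => rfl⟩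
  · have := hfin i
    omega
  · have h := Submodule.finrank_map_mkQ_add_finrank (coordHyperplane_le b i)
    have := hfin i
    rw [leibnizKernel_quotBr]
    omega
  · intro x y hxy
    refine sub_eq_zero.1 ((Submodule.mem_bot ℂ).1 ?_)
    rw [← iInf_coordHyperplane b, Submodule.mem_iInf]
    exact fun i => (Submodule.Quotient.eq _).1 (congrFun hxy i)
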